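/- Let m ≥ 2 and let A and D be the adjacency and degree matrices of the rose graph R_m^4 on N_m = 3m + 1 vertices. Then for every κ ∈ ℝ: det((κ² − 1)·I + D − κ·A) = (κ + 1)(κ − 1)(κ² + 1)(κ⁴ − 2m + 1)(κ⁶ + κ⁴ + κ² + 1)^{m−1}. -/

import Mathlib

open Finset
/-- Adjacency matrix of the rose graph `R_m^4` on `3m+1` vertices: vertex `0` is the hub;
for each petal `p`, vertices `3p+1`, `3p+2` are internal and `3p+3` is peripheral, with
edges `{0,3p+1}`, `{0,3p+2}`, `{3p+1,3p+3}`, `{3p+2,3p+3}`. -/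
noncomputable def roseA (m : ℕ) : Matrix (Fin (3 * m + 1)) (Fin (3 * m + 1)) ℝ :=
  fun i j =>
    if ((i : ℕ) = 0 ∧ (j : ℕ) % 3 ≠ 0) ∨ ((j : ℕ) = 0 ∧ (i : ℕ) % 3 ≠ 0)
        ∨ ((i : ℕ) % 3 = 1 ∧ (j : ℕ) = (i : ℕ) + 2)
        ∨ ((i : ℕ) % 3 = 2 ∧ (j : ℕ) = (i : ℕ) + 1)
        ∨ ((j : ℕ) % 3 = 1 ∧ (i : ℕ) = (j : ℕ) + 2)
        ∨ ((j : ℕ) % 3 = 2 ∧ (i : ℕ) = (j : ℕ) + 1)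
    then 1 else 0

/-- The vertices of the rose graph split into the hub and three vertices for each petal. -/
def roseEquiv (m : ℕ) : Unit ⊕ (Fin 3 × Fin m) ≃ Fin (3 * m + 1) where
  toFun := Sum.elim (fun _ => 0) fun x => ⟨3 * x.2 + x.1 + 1, by omega⟩
  invFun j := if h : (j : ℕ) = 0 then Sum.inl () else
    Sum.inr (⟨(j - 1) % 3, by omega⟩, ⟨(j - 1) / 3, by omega⟩)
  left_inv := by
    rintro (_ | ⟨i, p⟩)
    · simp
    · have h : 3 * (p : ℕ) + i + 1 ≠ 0 := by omega
      refine (dif_neg h).trans ?_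
      simp only [Sum.elim_inr, Sum.inr.injEq, Prod.mk.injEq, Fin.ext_iff]
      omega
  right_inv j := by
    by_cases h : (j : ℕ) = 0
    · simp [h, Fin.ext_iff]
    · simp only [h, dite_false, Sum.elim_inr, Fin.ext_iff]
      omega

/-- The neighbours of the hub inside one petal. -/
def petalHub : Fin 3 → ℝ := ![1, 1, 0]

/-- The adjacency matrix of a petal with the hub removed. -/
def petalA : Matrix (Fin 3) (Fin 3) ℝ := !![0, 0, 1; 0, 0, 1; 1, 1, 0]

lemma roseA_hub_hub (m : ℕ) (u v : Unit) :
    roseA m (roseEquiv m (Sum.inl u)) (roseEquiv m (Sum.inl v)) = 0 := by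
  simp [roseA, roseEquiv]

lemma roseA_hub_petal (m : ℕ) (u : Unit) (i : Fin 3) (p : Fin m) :
    roseA m (roseEquiv m (Sum.inl u)) (roseEquiv m (Sum.inr (i, p))) = petalHub i := by
  fin_cases i <;> simp [roseA, roseEquiv, petalHub] <;> omega

lemma roseA_petal_hub (m : ℕ) (u : Unit) (i : Fin 3) (p : Fin m) :
    roseA m (roseEquiv m (Sum.inr (i, p))) (roseEquiv m (Sum.inl u)) = petalHub i := by
  fin_cases i <;> simp [roseA, roseEquiv, petalHub] <;> omega

lemma roseA_petal_petal (m : ℕ) (i j : Fin 3) (p q : Fin m) :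
    roseA m (roseEquiv m (Sum.inr (i, p))) (roseEquiv m (Sum.inr (j, q))) =
      if p = q then petalA i j else 0 := by
  by_cases h : p = q
  · subst h
    fin_cases i <;> fin_cases j <;> simp [roseA, roseEquiv, petalA] <;> omega
  · have h' : (p : ℕ) ≠ q := fun e => h (Fin.ext e)
    rw [if_neg h, roseA, if_neg]
    simp only [roseEquiv, Equiv.coe_fn_mk, Sum.elim_inr]
    omega

lemma sum_roseA_hub (m : ℕ) (u : Unit) :
    ∑ j, roseA m (roseEquiv m (Sum.inl u)) j = 2 * m := by
  rw [← (roseEquiv m).sum_comp]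
  simp only [Fintype.sum_sum_type, Fintype.sum_prod_type, roseA_hub_hub, roseA_hub_petal]
  simp [Fin.sum_univ_three, petalHub]
  ring

lemma sum_roseA_petal (m : ℕ) (i : Fin 3) (p : Fin m) :
    ∑ j, roseA m (roseEquiv m (Sum.inr (i, p))) j = 2 := by
  rw [← (roseEquiv m).sum_comp]
  simp only [Fintype.sum_sum_type, Fintype.sum_prod_type, roseA_petal_hub, roseA_petal_petal]
  fin_cases i <;> simp [Fin.sum_univ_three, petalHub, petalA] <;> norm_num

/-- The Ihara block of a single petal. -/
def petalBlock (κ : ℝ) : Matrix (Fin 3) (Fin 3) ℝ :=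
  (κ ^ 2 + 1) • (1 : Matrix (Fin 3) (Fin 3) ℝ) - κ • petalA

lemma det_petalBlock (κ : ℝ) : (petalBlock κ).det = κ ^ 6 + κ ^ 4 + κ ^ 2 + 1 := by
  simp [petalBlock, petalA, Matrix.det_fin_three]
  ring

lemma ihara_submatrix_roseEquiv (m : ℕ) (κ : ℝ) :
    ((κ ^ 2 - 1) • (1 : Matrix (Fin (3 * m + 1)) (Fin (3 * m + 1)) ℝ)
        + Matrix.diagonal (fun i => ∑ j, roseA m i j) - κ • roseA m).submatrix
          (roseEquiv m) (roseEquiv m)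
      = Matrix.fromBlocks (Matrix.of fun _ _ => κ ^ 2 - 1 + 2 * m)
          (Matrix.of fun _ x => -κ * petalHub x.1)
          (Matrix.of fun x _ => -κ * petalHub x.1)
          (Matrix.blockDiagonal fun _ => petalBlock κ) := by
  ext x y
  rcases x with u | ⟨i, p⟩ <;> rcases y with v | ⟨j, q⟩
  · simp [sum_roseA_hub, roseA_hub_hub]
  · simp [roseA_hub_petal]
  · simp [roseA_petal_hub]
  · simp only [Matrix.submatrix_apply, Matrix.sub_apply, Matrix.add_apply, Matrix.smul_apply,
      Matrix.one_apply, Matrix.diagonal_apply, (roseEquiv m).injective.eq_iff, Sum.inr.injEq,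
      Prod.mk.injEq, sum_roseA_petal, roseA_petal_petal, Matrix.fromBlocks_apply₂₂,
      Matrix.blockDiagonal_apply, petalBlock, smul_eq_mul]
    by_cases hp : p = q <;> by_cases hi : i = j <;> simp [hp, hi]
    ring

/-- The vector solving `petalBlock κ *ᵥ x = -κ • petalHub`. -/
noncomputable def petalSolution (κ : ℝ) : Fin 3 → ℝ :=
  ![-κ * (κ ^ 2 + 1) / (κ ^ 4 + 1), -κ * (κ ^ 2 + 1) / (κ ^ 4 + 1), -2 * κ ^ 2 / (κ ^ 4 + 1)]

lemma petalBlock_mul_petalSolution (κ : ℝ) (i : Fin 3) :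
    ∑ j, petalBlock κ i j * petalSolution κ j = -κ * petalHub i := by
  have h : κ ^ 4 + 1 ≠ 0 := by positivity
  fin_cases i <;>
    simp [Fin.sum_univ_three, petalBlock, petalA, petalSolution, petalHub, Matrix.one_apply] <;>
    field_simp <;> ring

lemma det_fromBlocks_of_mul_eq {R n l : Type*} [CommRing R] [Fintype n] [DecidableEq n]
    [Fintype l] [DecidableEq l] (A : Matrix n n R) (B : Matrix n l R) (C : Matrix l n R)
    (D : Matrix l l R) (X : Matrix l n R) (h : D * X = C) :
    (Matrix.fromBlocks A B C D).det = (A - B * X).det * D.det := by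
  have key : Matrix.fromBlocks A B C D * Matrix.fromBlocks 1 0 (-X) 1 =
      Matrix.fromBlocks (A - B * X) B 0 D := by
    simp [Matrix.fromBlocks_multiply, h, sub_eq_add_neg]
  simpa using congrArg Matrix.det key

/-- The Ihara determinant of the rose graph `R_m^4` factorizes as
`det((κ²-1)I + D - κA) = (κ+1)(κ-1)(κ²+1)(κ⁴-2m+1)(κ⁶+κ⁴+κ²+1)^{m-1}`. -/
theorem rose_ihara_det (m : ℕ) (hm : 2 ≤ m) (κ : ℝ) :
    ((κ ^ 2 - 1) • (1 : Matrix (Fin (3 * m + 1)) (Fin (3 * m + 1)) ℝ)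
        + Matrix.diagonal (fun i => ∑ j, roseA m i j) - κ • roseA m).det
      = (κ + 1) * (κ - 1) * (κ ^ 2 + 1) * (κ ^ 4 - 2 * (m : ℝ) + 1)
          * (κ ^ 6 + κ ^ 4 + κ ^ 2 + 1) ^ (m - 1) := by
  rw [← Matrix.det_submatrix_equiv_self (roseEquiv m), ihara_submatrix_roseEquiv,
    det_fromBlocks_of_mul_eq _ _ _ _ (Matrix.of fun x _ => petalSolution κ x.1)]
  · have h : κ ^ 4 + 1 ≠ 0 := by positivity
    obtain ⟨n, rfl⟩ : ∃ n, m = n + 1 := ⟨m - 1, by omega⟩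
    rw [Matrix.det_blockDiagonal]
    simp only [det_petalBlock, Finset.prod_const, Finset.card_univ, Fintype.card_fin, pow_succ _ n,
      Nat.add_sub_cancel, Matrix.det_unique, Matrix.sub_apply, Matrix.mul_apply, Matrix.of_apply,
      Fintype.sum_prod_type, Finset.sum_const, Fin.sum_univ_three]
    simp [petalHub, petalSolution]
    field_simp
    ring
  · ext ⟨i, p⟩ u
    simp [Matrix.mul_apply, Fintype.sum_prod_type, Matrix.blockDiagonal_apply,
      petalBlock_mul_petalSolution]
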